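/- For every j ∈ {2,3,4} and λ ∈ {1,-1}, there do not exist a nowhere-vanishing smooth function m : ℝ³ → ℝ and a nonzero constant vector C ∈ ℝ⁴ such that L₁N(s,t,w) = m(s,t,w)·(N(s,t,w) + C) for all (s,t,w) ∈ ℝ³. In other words, no tubular hypersurface obtained by pseudo hyperspheres or pseudo hyperbolic hyperspheres whose centers lie on a spacelike curve with non-null Frenet vector fields in E⁴₁ has second kind L₁-pointwise 1-type Gauss map. -/

import Mathlib

noncomputable section

open Real

set_option linter.unusedVariables false

/-- Minkowski inner product on `ℝ⁴` with signature `(-,+,+,+)`. -/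
def mink (u v : Fin 4 → ℝ) : ℝ :=
  -(u 0 * v 0) + u 1 * v 1 + u 2 * v 2 + u 3 * v 3

/-- `εᵢ = ⟨Fᵢ,Fᵢ⟩` : equals `-1` if `i = j` and `1` otherwise. -/
def eps (j i : ℕ) : ℝ := if i = j then -1 else 1

/-- `σ = 1` if `j = 2` and `σ = -1` if `j ∈ {3,4}`. -/
def sigma' (j : ℕ) : ℝ := if j = 2 then 1 else -1

/-- `τ = 1` if `j ∈ {2,3}` and `τ = -1` if `j = 4`. -/
def tau' (j : ℕ) : ℝ := if j = 4 then -1 else 1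

/-- The functions `μ₂, μ₃, μ₄` defined by the cyclic index rule
(`μ₅ := μ₂`, `μ₆ := μ₃`): `μⱼ = cosh t·sinh w`, `μⱼ₊₁ = cosh w`,
`μⱼ₊₂ = sinh t·sinh w` if `λ = 1`, and `μⱼ = cosh t·cosh w`,
`μⱼ₊₁ = sinh w`, `μⱼ₊₂ = sinh t·cosh w` if `λ = -1`. -/
def mu (j : ℕ) (lam : ℝ) (i : ℕ) (t w : ℝ) : ℝ :=
  if (i + 3 - j) % 3 = 0 then cosh t * (if lam = 1 then sinh w else cosh w)
  else if (i + 3 - j) % 3 = 1 then (if lam = 1 then cosh w else sinh w)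
  else sinh t * (if lam = 1 then sinh w else cosh w)

/-- Gauss map of the tubular hypersurface `T^{j,λ}` about a spacelike curve of type `j`. -/
def gaussNJ (j : ℕ) (lam : ℝ) (F₂ F₃ F₄ : ℝ → Fin 4 → ℝ) (s t w : ℝ) : Fin 4 → ℝ :=
  (-(sigma' j) * lam ^ j) •
    (mu j lam 2 t w • F₂ s + mu j lam 3 t w • F₃ s + mu j lam 4 t w • F₄ s)

/-- The tubular hypersurface `T^{j,λ}` about a spacelike curve of type `j`. -/
def tubeTJ (j : ℕ) (lam r : ℝ) (β F₂ F₃ F₄ : ℝ → Fin 4 → ℝ) (s t w : ℝ) : Fin 4 → ℝ :=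
  β s + r • (mu j lam 2 t w • F₂ s + mu j lam 3 t w • F₃ s + mu j lam 4 t w • F₄ s)

/-- The function `D(s,t,w) = σ + r k₁(s) μ₂(t,w)`. -/
def DJ (j : ℕ) (lam r : ℝ) (k₁ : ℝ → ℝ) (s t w : ℝ) : ℝ :=
  sigma' j + r * k₁ s * mu j lam 2 t w

/-- The Cheng–Yau operator `ℒ₁` applied to the Gauss map of `T^{j,λ}`. -/
def L1NJ (j : ℕ) (lam r : ℝ) (k₁ k₂ : ℝ → ℝ) (F₁ F₂ F₃ F₄ : ℝ → Fin 4 → ℝ)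
    (s t w : ℝ) : Fin 4 → ℝ :=
  (2 * (-(tau' j) * k₁ s * k₂ s * mu j lam 3 t w + deriv k₁ s * mu j lam 2 t w)
      / (r * (DJ j lam r k₁ s t w) ^ 3)) • F₁ s
  + (-2 * lam * (mu j lam 2 t w + 3 * r ^ 2 * (k₁ s) ^ 2 * (mu j lam 2 t w) ^ 3
      + k₁ s * (lam * r + 4 * sigma' j * r * (mu j lam 2 t w) ^ 2))
      / (r ^ 3 * (DJ j lam r k₁ s t w) ^ 2)) • F₂ s
  + (-2 * lam * sigma' j * mu j lam 3 t w * (1 + 3 * sigma' j * r * k₁ s * mu j lam 2 t w)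
      / (r ^ 3 * DJ j lam r k₁ s t w)) • F₃ s
  + (-2 * lam * mu j lam 4 t w * (sigma' j + 3 * r * k₁ s * mu j lam 2 t w)
      / (r ^ 3 * DJ j lam r k₁ s t w)) • F₄ s

/-- The operator `ℒ₂` applied to the Gauss map of `T^{j,λ}`. -/
def L2NJ (j : ℕ) (lam r : ℝ) (k₁ k₂ : ℝ → ℝ) (F₁ F₂ F₃ F₄ : ℝ → Fin 4 → ℝ)
    (s t w : ℝ) : Fin 4 → ℝ :=
  (lam ^ j * ((-1 : ℝ) ^ j * mu j lam 3 t w * k₁ s * k₂ s - sigma' j * mu j lam 2 t w * deriv k₁ s)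
      / (r ^ 2 * (DJ j lam r k₁ s t w) ^ 3)) • F₁ s
  + (-lam ^ (j + 1) * k₁ s * (2 * lam * sigma' j - 3 * (-1 : ℝ) ^ j * (mu j lam 4 t w) ^ 2
      - 3 * tau' j * (mu j lam 3 t w) ^ 2 - 3 * sigma' j * r * k₁ s * (mu j lam 2 t w) ^ 3)
      / (r ^ 3 * (DJ j lam r k₁ s t w) ^ 2)) • F₂ s
  + (3 * tau' j * lam ^ (j + 1) * r * k₁ s * mu j lam 2 t w * mu j lam 3 t w
      / (r ^ 4 * (tau' j + (-1 : ℝ) ^ j * r * k₁ s * mu j lam 2 t w))) • F₃ s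
  + (3 * tau' j * lam ^ (j + 1) * r * k₁ s * mu j lam 2 t w * mu j lam 4 t w
      / (r ^ 4 * (tau' j + (-1 : ℝ) ^ j * r * k₁ s * mu j lam 2 t w))) • F₄ s

lemma mink_combination (a b c d : ℝ) (u v w z x : Fin 4 → ℝ) :
    mink (a • u + b • v + c • w + d • z) x
      = a * mink u x + b * mink v x + c * mink w x + d * mink z x := by
  simp only [mink, Pi.add_apply, Pi.smul_apply, smul_eq_mul]
  ring

lemma mink_comm (u v : Fin 4 → ℝ) : mink u v = mink v u := by
  simp only [mink]
  ring

lemma eps_ne_zero (j i : ℕ) : eps j i ≠ 0 := by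
  unfold eps
  split_ifs <;> norm_num

/-- A frame that is orthogonal with non-null vectors is linearly independent. -/
lemma coeffs_eq_zero_of_frame {e₁ e₂ e₃ e₄ : Fin 4 → ℝ}
    (h₁ : mink e₁ e₁ ≠ 0) (h₂ : mink e₂ e₂ ≠ 0) (h₃ : mink e₃ e₃ ≠ 0) (h₄ : mink e₄ e₄ ≠ 0)
    (h₁₂ : mink e₁ e₂ = 0) (h₁₃ : mink e₁ e₃ = 0) (h₁₄ : mink e₁ e₄ = 0)
    (h₂₃ : mink e₂ e₃ = 0) (h₂₄ : mink e₂ e₄ = 0) (h₃₄ : mink e₃ e₄ = 0)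
    {a b c d : ℝ} (h : a • e₁ + b • e₂ + c • e₃ + d • e₄ = 0) :
    a = 0 ∧ b = 0 ∧ c = 0 ∧ d = 0 := by
  have key (x : Fin 4 → ℝ) :
      a * mink e₁ x + b * mink e₂ x + c * mink e₃ x + d * mink e₄ x = 0 := by
    rw [← mink_combination, h]
    simp [mink]
  have k₁ := key e₁
  have k₂ := key e₂
  have k₃ := key e₃
  have k₄ := key e₄
  simp only [mink_comm e₂ e₁, mink_comm e₃ e₁, mink_comm e₄ e₁, mink_comm e₃ e₂,
    mink_comm e₄ e₂, mink_comm e₄ e₃, h₁₂, h₁₃, h₁₄, h₂₃, h₂₄, h₃₄, mul_zero, add_zero,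
    zero_add] at k₁ k₂ k₃ k₄
  simp_all

/-- A constant vector `C` with `A = m (N + C)`, where `A` and `N` are given in an orthogonal
frame, has coordinates in that frame, and the equation holds coordinatewise. -/
lemma exists_frame_coeffs {ι : Type*} [Nonempty ι] {e₁ e₂ e₃ e₄ C : Fin 4 → ℝ}
    (h₁ : mink e₁ e₁ ≠ 0) (h₂ : mink e₂ e₂ ≠ 0) (h₃ : mink e₃ e₃ ≠ 0) (h₄ : mink e₄ e₄ ≠ 0)
    (h₁₂ : mink e₁ e₂ = 0) (h₁₃ : mink e₁ e₃ = 0) (h₁₄ : mink e₁ e₄ = 0)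
    (h₂₃ : mink e₂ e₃ = 0) (h₂₄ : mink e₂ e₄ = 0) (h₃₄ : mink e₃ e₄ = 0)
    {ν : ℝ} {m A₁ A₂ A₃ A₄ x y z : ι → ℝ} (hm : ∀ p, m p ≠ 0)
    (h : ∀ p, A₁ p • e₁ + A₂ p • e₂ + A₃ p • e₃ + A₄ p • e₄
      = m p • (ν • (x p • e₂ + y p • e₃ + z p • e₄) + C)) :
    ∃ a b c d : ℝ, C = a • e₁ + b • e₂ + c • e₃ + d • e₄ ∧
      ∀ p, A₁ p = m p * a ∧ A₂ p = m p * (ν * x p + b) ∧ A₃ p = m p * (ν * y p + c) ∧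
        A₄ p = m p * (ν * z p + d) := by
  obtain ⟨q⟩ := ‹Nonempty ι›
  have hC : C = ((m q)⁻¹ * A₁ q) • e₁ + ((m q)⁻¹ * A₂ q - ν * x q) • e₂
      + ((m q)⁻¹ * A₃ q - ν * y q) • e₃ + ((m q)⁻¹ * A₄ q - ν * z q) • e₄ := by
    have hq := congrArg ((m q)⁻¹ • ·) (h q)
    simp only [inv_smul_smul₀ (hm q)] at hq
    rw [← sub_eq_iff_eq_add'.2 hq]
    module
  refine ⟨_, _, _, _, hC, fun p => ?_⟩
  generalize (m q)⁻¹ * A₁ q = a, (m q)⁻¹ * A₂ q - ν * x q = b,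
    (m q)⁻¹ * A₃ q - ν * y q = c, (m q)⁻¹ * A₄ q - ν * z q = d at hC ⊢
  have hp := sub_eq_zero.2 (h p)
  rw [hC] at hp
  have hp' : (A₁ p - m p * a) • e₁ + (A₂ p - m p * (ν * x p + b)) • e₂
      + (A₃ p - m p * (ν * y p + c)) • e₃ + (A₄ p - m p * (ν * z p + d)) • e₄ = 0 := by
    rw [← hp]
    module
  simpa only [sub_eq_zero] using
    coeffs_eq_zero_of_frame h₁ h₂ h₃ h₄ h₁₂ h₁₃ h₁₄ h₂₃ h₂₄ h₃₄ hp'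

lemma quadratic_coeffs_eq_zero {α β γ x y z : ℝ} (hxy : x < y) (hyz : y < z)
    (hx : α + β * x + γ * x ^ 2 = 0) (hy : α + β * y + γ * y ^ 2 = 0)
    (hz : α + β * z + γ * z ^ 2 = 0) : α = 0 ∧ β = 0 ∧ γ = 0 := by
  have e₁ : β + γ * (x + y) = 0 := by
    apply mul_left_cancel₀ (sub_ne_zero.2 hxy.ne')
    linear_combination hy - hx
  have e₂ : β + γ * (y + z) = 0 := by
    apply mul_left_cancel₀ (sub_ne_zero.2 hyz.ne')
    linear_combination hz - hy
  have hγ : γ = 0 := by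
    apply mul_left_cancel₀ (sub_ne_zero.2 (hxy.trans hyz).ne')
    linear_combination e₂ - e₁
  subst hγ
  have hβ : β = 0 := by linarith
  subst hβ
  exact ⟨by linarith, rfl, rfl⟩

lemma mu_pos (j : ℕ) (lam : ℝ) (i : ℕ) {u : ℝ} (hu : 0 < u) : 0 < mu j lam i u u := by
  have hs := sinh_pos_iff.2 hu
  have hc := cosh_pos u
  unfold mu
  split_ifs <;> positivity

lemma mu_diag_lt (j : ℕ) (lam : ℝ) (i : ℕ) {u v : ℝ} (hu : 0 < u) (huv : u < v) :
    mu j lam i u u < mu j lam i v v := by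
  have hs := sinh_pos_iff.2 hu
  have hc := cosh_pos u
  have hs' : sinh u < sinh v := sinh_lt_sinh.2 huv
  have hc' : cosh u < cosh v :=
    cosh_lt_cosh.2 (by rwa [abs_of_pos hu, abs_of_pos (hu.trans huv)])
  unfold mu
  split_ifs <;> first | assumption | gcongr

lemma mu_three_four_independent {j : ℕ} (hj : j = 2 ∨ j = 3 ∨ j = 4) (lam : ℝ) :
    mu j lam 3 0 1 * mu j lam 4 1 1 - mu j lam 4 0 1 * mu j lam 3 1 1 ≠ 0 := by
  have hs : sinh 1 ≠ 0 := (sinh_pos_iff.2 one_pos).ne'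
  have hc : cosh 1 ≠ 0 := (cosh_pos 1).ne'
  have hc' : cosh 1 - 1 ≠ 0 := (sub_pos.2 (one_lt_cosh.2 one_ne_zero)).ne'
  by_cases hl : lam = 1 <;> rcases hj with rfl | rfl | rfl <;>
    simp only [mu, hl, if_true, if_false, cosh_zero, sinh_zero, Nat.reduceAdd, Nat.reduceSub,
      Nat.reduceMod, one_ne_zero, OfNat.ofNat_ne_zero, OfNat.ofNat_ne_one,
      one_mul, zero_mul, zero_sub, sub_zero, zero_ne_one, neg_ne_zero, ne_eq] <;>
    first
    | (simp only [mul_eq_zero, hs, hc, or_self, not_false_eq_true])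
    | (intro h
       have : (cosh 1 - 1) * (sinh 1 * cosh 1) = 0 := by linear_combination -h
       simp_all)

/-- The scalar system obtained by comparing frame coefficients has only the zero solution. -/
lemma frame_coefficients_eq_zero {ι : Type*} {σ lam τ ν r k k' l : ℝ} {x y z m D : ι → ℝ}
    {a b c d : ℝ}
    (hσ : σ ^ 2 = 1) (hlam : lam ^ 2 = 1) (hν : ν ^ 2 = 1) (hr : 0 < r)
    (hDdef : ∀ p, D p = σ + r * k * x p) (hD : ∀ p, D p ≠ 0) (hm : ∀ p, m p ≠ 0)
    (h₁ : ∀ p, 2 * (-τ * k * l * y p + k' * x p) / (r * D p ^ 3) = m p * a)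
    (h₂ : ∀ p, -2 * lam * (x p + 3 * r ^ 2 * k ^ 2 * x p ^ 3
      + k * (lam * r + 4 * σ * r * x p ^ 2)) / (r ^ 3 * D p ^ 2) = m p * (ν * x p + b))
    (h₃ : ∀ p, -2 * lam * σ * y p * (1 + 3 * σ * r * k * x p) / (r ^ 3 * D p)
      = m p * (ν * y p + c))
    (h₄ : ∀ p, -2 * lam * z p * (σ + 3 * r * k * x p) / (r ^ 3 * D p)
      = m p * (ν * z p + d))
    {p₀ p₁ p₂ p₃ : ι} (hind : y p₀ * z p₁ - z p₀ * y p₁ ≠ 0)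
    (hx₁₂ : x p₁ < x p₂) (hx₂₃ : x p₂ < x p₃)
    (hy₁ : y p₁ ≠ 0) (hy₂ : y p₂ ≠ 0) (hy₃ : y p₃ ≠ 0) :
    a = 0 ∧ b = 0 ∧ c = 0 ∧ d = 0 := by
  have hr0 := hr.ne'
  have hσ0 : σ ≠ 0 := by rintro rfl; norm_num at hσ
  have hlam0 : lam ≠ 0 := by rintro rfl; norm_num at hlam
  have hν0 : ν ≠ 0 := by rintro rfl; norm_num at hν
  have cross (p : ι) : c * z p = d * y p := by
    apply mul_left_cancel₀ (hm p)
    have e₃ := h₃ p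
    have e₄ := h₄ p
    have hDp := hD p
    field_simp at e₃ e₄
    apply mul_left_cancel₀ (mul_ne_zero (pow_ne_zero 3 hr0) hDp)
    linear_combination y p * e₄ - z p * e₃ + 6 * lam * y p * z p * r * k * x p * -hσ
  have hc : c = 0 := by
    apply mul_left_cancel₀ hind
    linear_combination y p₀ * cross p₁ - y p₁ * cross p₀
  have hd : d = 0 := by
    apply mul_left_cancel₀ hind
    linear_combination z p₀ * cross p₁ - z p₁ * cross p₀
  have hmul (p : ι) (hy : y p ≠ 0) :
      -2 * lam * σ * (1 + 3 * σ * r * k * x p) = m p * ν * (r ^ 3 * D p) := by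
    have e₃ := h₃ p
    have hDp := hD p
    rw [hc, div_eq_iff (by positivity)] at e₃
    apply mul_left_cancel₀ hy
    linear_combination e₃
  have hquad (p : ι) (hy : y p ≠ 0) :
      (lam * b - ν * r * k) + lam * b * 4 * σ * r * k * x p
        + lam * b * 3 * (r * k) ^ 2 * x p ^ 2 = 0 := by
    have e₂ := h₂ p
    have e := hmul p hy
    have hDp := hD p
    rw [div_eq_iff (by positivity)] at e₂
    rw [hDdef p] at e₂ e
    linear_combination (1 / 2) * (ν * e₂ - (ν * x p + b) * (σ + r * k * x p) * e)
      - lam * (ν * x p + b) * (1 + 3 * σ * (r * k) * x p + 3 * (r * k) ^ 2 * x p ^ 2) * hσ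
      + ν * r * k * hlam
  obtain ⟨q₀, q₁, q₂⟩ := quadratic_coeffs_eq_zero hx₁₂ hx₂₃ (hquad _ hy₁) (hquad _ hy₂) (hquad _ hy₃)
  have hbk : b * k = 0 := by
    have : (lam * 4 * σ * r) * (b * k) = 0 := by linear_combination q₁
    simpa [hlam0, hσ0, hr0] using this
  have hk : k = 0 := by
    have : (ν * r) * k ^ 2 = 0 := by linear_combination lam * hbk - k * q₀
    simpa [hν0, hr0] using this
  subst hk
  have hb : b = 0 := by simpa [hlam0] using q₀
  have hlin (p : ι) (hy : y p ≠ 0) : lam * σ * a + ν * r ^ 2 * k' * x p + 0 * x p ^ 2 = 0 := by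
    have e₁ := h₁ p
    have e := hmul p hy
    have hDp : D p = σ := by rw [hDdef p]; ring
    rw [hDp, div_eq_iff (by positivity)] at e₁
    rw [hDp] at e
    linear_combination (1 / 2) * (ν * r ^ 2 * e₁ - a * σ ^ 2 * e) - lam * σ * a * hσ
  obtain ⟨ha, -, -⟩ := quadratic_coeffs_eq_zero hx₁₂ hx₂₃ (hlin _ hy₁) (hlin _ hy₂) (hlin _ hy₃)
  exact ⟨by simpa [hlam0, hσ0] using ha, hb, hc, hd⟩

theorem no_second_kind_L1_pointwise_one_type_gauss_map_spacelike
    (j : ℕ) (hj : j = 2 ∨ j = 3 ∨ j = 4) (lam : ℝ) (hlam : lam = 1 ∨ lam = -1)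
    (r : ℝ) (hr : 0 < r)
    (β F₁ F₂ F₃ F₄ : ℝ → Fin 4 → ℝ) (k₁ k₂ k₃ : ℝ → ℝ)
    (hβ : ContDiff ℝ (⊤ : ℕ∞) β) (hF₁ : ContDiff ℝ (⊤ : ℕ∞) F₁) (hF₂ : ContDiff ℝ (⊤ : ℕ∞) F₂)
    (hF₃ : ContDiff ℝ (⊤ : ℕ∞) F₃) (hF₄ : ContDiff ℝ (⊤ : ℕ∞) F₄)
    (hk₁ : ContDiff ℝ (⊤ : ℕ∞) k₁) (hk₂ : ContDiff ℝ (⊤ : ℕ∞) k₂) (hk₃ : ContDiff ℝ (⊤ : ℕ∞) k₃)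
    (hβ' : ∀ s, deriv β s = F₁ s)
    (hF₁₁ : ∀ s, mink (F₁ s) (F₁ s) = eps j 1)
    (hF₂₂ : ∀ s, mink (F₂ s) (F₂ s) = eps j 2)
    (hF₃₃ : ∀ s, mink (F₃ s) (F₃ s) = eps j 3)
    (hF₄₄ : ∀ s, mink (F₄ s) (F₄ s) = eps j 4)
    (hF₁₂ : ∀ s, mink (F₁ s) (F₂ s) = 0)
    (hF₁₃ : ∀ s, mink (F₁ s) (F₃ s) = 0)
    (hF₁₄ : ∀ s, mink (F₁ s) (F₄ s) = 0)
    (hF₂₃ : ∀ s, mink (F₂ s) (F₃ s) = 0)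
    (hF₂₄ : ∀ s, mink (F₂ s) (F₄ s) = 0)
    (hF₃₄ : ∀ s, mink (F₃ s) (F₄ s) = 0)
    (hFr₁ : ∀ s, deriv F₁ s = k₁ s • F₂ s)
    (hFr₂ : ∀ s, deriv F₂ s = (-(eps j 1 * eps j 2) * k₁ s) • F₁ s + k₂ s • F₃ s)
    (hFr₃ : ∀ s, deriv F₃ s = (-(eps j 2 * eps j 3) * k₂ s) • F₂ s + k₃ s • F₄ s)
    (hFr₄ : ∀ s, deriv F₄ s = (-(eps j 3 * eps j 4) * k₃ s) • F₃ s)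
    (hD : ∀ s t w : ℝ, DJ j lam r k₁ s t w ≠ 0)
    :
    ¬ ∃ (m : ℝ × ℝ × ℝ → ℝ) (C : Fin 4 → ℝ),
      ContDiff ℝ (⊤ : ℕ∞) m ∧ (∀ p, m p ≠ 0) ∧ C ≠ 0 ∧
        ∀ s t w : ℝ, L1NJ j lam r k₁ k₂ F₁ F₂ F₃ F₄ s t w
          = m (s, t, w) • (gaussNJ j lam F₂ F₃ F₄ s t w + C) := by
  rintro ⟨m, C, -, hm, hC, h⟩
  have hσ : sigma' j ^ 2 = 1 := by unfold sigma'; split_ifs <;> norm_num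
  have hlam2 : lam ^ 2 = 1 := by rcases hlam with rfl | rfl <;> norm_num
  have hν : (-(sigma' j) * lam ^ j) ^ 2 = 1 := by
    rw [mul_pow, neg_sq, hσ, one_mul, ← pow_mul, mul_comm, pow_mul, hlam2, one_pow]
  have hpos (i : ℕ) {u : ℝ} (hu : 0 < u) : mu j lam i u u ≠ 0 := (mu_pos j lam i hu).ne'
  obtain ⟨a, b, c, d, hCspan, hcoeff⟩ := exists_frame_coeffs
    (by rw [hF₁₁]; exact eps_ne_zero _ _) (by rw [hF₂₂]; exact eps_ne_zero _ _)
    (by rw [hF₃₃]; exact eps_ne_zero _ _) (by rw [hF₄₄]; exact eps_ne_zero _ _)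
    (hF₁₂ 0) (hF₁₃ 0) (hF₁₄ 0) (hF₂₃ 0) (hF₂₄ 0) (hF₃₄ 0)
    (fun p : ℝ × ℝ => hm (0, p.1, p.2)) (fun p : ℝ × ℝ => h 0 p.1 p.2)
  obtain ⟨rfl, rfl, rfl, rfl⟩ := frame_coefficients_eq_zero hσ hlam2 hν hr
    (fun _ => rfl) (fun p : ℝ × ℝ => hD 0 p.1 p.2) (fun p => hm (0, p.1, p.2))
    (fun p => (hcoeff p).1) (fun p => (hcoeff p).2.1) (fun p => (hcoeff p).2.2.1)
    (fun p => (hcoeff p).2.2.2) (p₀ := (0, 1)) (p₁ := (1, 1)) (p₂ := (2, 2)) (p₃ := (3, 3))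
    (mu_three_four_independent hj lam)
    (mu_diag_lt j lam 2 (by norm_num) (by norm_num))
    (mu_diag_lt j lam 2 (by norm_num) (by norm_num))
    (hpos 3 (by norm_num)) (hpos 3 (by norm_num)) (hpos 3 (by norm_num))
  exact hC (by simpa using hCspan)
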